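/- arXiv:1203.4295 — 4 statements merged into one kernel-verified Lean document; each statement's English description precedes it below -/
import Mathlib

section
/- Let α be an irrational real number whose regular continued fraction expansion α = [a₀; a₁♯, a₂♯, a₃♯, …] has unbounded partial quotients, i.e. the sequence (a_n♯) is unbounded. Then {M₊(α,β) : β ∈ ℝ} = [0, M₊(α)], the closed interval from 0 to M₊(α), where M₊(α) = sup_{β∈ℝ} M₊(α,β). -/
open Filter Finset

/-- Distance from `x` to the nearest integer. -/
noncomputable def nint (x : ℝ) : ℝ := |x - (round x : ℝ)|

/-- One-sided inhomogeneous approximation constant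
`M₊(α,β) = liminf_{q→∞} q‖qα−β‖` over positive integers `q`. -/
noncomputable def Mplus (α β : ℝ) : ℝ :=
  Filter.liminf (fun q : ℕ => (q : ℝ) * nint (q * α - β)) Filter.atTop

/-- Complete quotients of the negative continued fraction: `ncq α i = α_{i+1}`,
so `ncq α 0 = α₁ = α` and `α_{i+1} = a_i - 1/α_i` with `a_i = ⌈1/α_i⌉`. -/
noncomputable def ncq (α : ℝ) : ℕ → ℝ
  | 0 => α
  | i + 1 => (⌈(ncq α i)⁻¹⌉ : ℝ) - (ncq α i)⁻¹

/-- Partial quotients of the negative continued fraction: `npq α i = a_i = ⌈1/α_i⌉` for `i ≥ 1`. -/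
noncomputable def npq (α : ℝ) (i : ℕ) : ℤ := ⌈(ncq α (i - 1))⁻¹⌉

/-- Convergent denominators: `q₀ = 1`, `q₁ = a₁`, `q_{i+2} = a_{i+2} q_{i+1} − q_i`. -/
noncomputable def nq (α : ℝ) : ℕ → ℤ
  | 0 => 1
  | 1 => npq α 1
  | i + 2 => npq α (i + 2) * nq α (i + 1) - nq α i

/-- Convergent numerators: `p₀ = 0`, `p₁ = 1`, `p_{i+2} = a_{i+2} p_{i+1} − p_i`. -/
noncomputable def np (α : ℝ) : ℕ → ℤ
  | 0 => 0
  | 1 => 1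
  | i + 2 => npq α (i + 2) * np α (i + 1) - np α i

/-- `Dk α k = α₁α₂⋯α_k` (with `Dk α 0 = 1`). -/
noncomputable def Dk (α : ℝ) (k : ℕ) : ℝ := ∏ j ∈ Finset.range k, ncq α j

/-- Davenport remainders: `drem α β i = β_{i+1}`, so `drem α β 0 = β₁ = β` and
`β_{i+1} = β_i/α_i − ⌊β_i/α_i⌋`. -/
noncomputable def drem (α β : ℝ) : ℕ → ℝ
  | 0 => β
  | i + 1 => Int.fract (drem α β i / ncq α i)

/-- Davenport coefficients: `db α β i = b_i = ⌊β_i/α_i⌋` for `i ≥ 1`. -/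
noncomputable def db (α β : ℝ) (i : ℕ) : ℤ := ⌊drem α β (i - 1) / ncq α (i - 1)⌋

/-- `Qn α β n = Σ_{k=1}^n b_k q_{k−1}`. -/
noncomputable def Qn (α β : ℝ) (n : ℕ) : ℤ :=
  ∑ k ∈ Finset.Icc 1 n, db α β k * nq α (k - 1)

/-- `Q′_n`. -/
noncomputable def Qn' (α β : ℝ) (n : ℕ) : ℤ :=
  if Qn α β n < nq α n - nq α (n - 1) then Qn α β n + nq α (n - 1)
  else Qn α β n + nq α (n - 1) - nq α n

/-- `λ_n(β) = Q_n D_n β_{n+1}`. -/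
noncomputable def lam (α β : ℝ) (n : ℕ) : ℝ :=
  (Qn α β n : ℝ) * Dk α n * drem α β n

/-- `ρ_n(β)`. -/
noncomputable def rho (α β : ℝ) (n : ℕ) : ℝ :=
  if Qn α β n < nq α n - nq α (n - 1)
  then (Qn' α β n : ℝ) * Dk α n * (1 - drem α β n)
  else (Qn' α β n : ℝ) * Dk α n * (1 - ncq α n - drem α β n)

/-- Reversed quotients: `ᾱ₀ = 0`, `ᾱ_i = 1/(a_i − ᾱ_{i−1})`. -/
noncomputable def rq (α : ℝ) : ℕ → ℝ
  | 0 => 0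
  | i + 1 => ((npq α (i + 1) : ℝ) - rq α i)⁻¹

/-- Gauss-map iterates for the regular continued fraction: `gm α 0 = {α}` and
`gm α (n+1) = {1/(gm α n)}`; the regular partial quotient `a♯_{n+1}` is `⌊1/(gm α n)⌋`. -/
noncomputable def gm (α : ℝ) : ℕ → ℝ
  | 0 => Int.fract α
  | n + 1 => Int.fract (gm α n)⁻¹

/-- The quantity `q‖qα−β‖` whose lower limit is `Mplus α β`. -/
noncomputable def scaledDist (α β : ℝ) (q : ℕ) : ℝ := (q : ℝ) * nint (q * α - β)

/-- `p / N` is a reduced fraction with `N |Nα - p| ≤ ε`. -/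
def IsGoodApprox (α ε : ℝ) (N : ℕ) (p : ℤ) : Prop :=
  0 < N ∧ IsCoprime p (N : ℤ) ∧ |N * α - p| ≤ ε / N

lemma nint_eq_norm (x : ℝ) : nint x = ‖(x : UnitAddCircle)‖ :=
  (UnitAddCircle.norm_eq).symm

lemma nint_nonneg (x : ℝ) : 0 ≤ nint x := abs_nonneg _

lemma nint_add_intCast (x : ℝ) (n : ℤ) : nint (x + n) = nint x := by
  simp [nint, round_add_intCast]

lemma nint_le_abs_sub (x : ℝ) (n : ℤ) : nint x ≤ |x - n| := round_le x n

lemma nint_le_add_abs_sub (x y : ℝ) : nint x ≤ nint y + |x - y| := by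
  have h := nint_le_abs_sub x (round y)
  have h2 : |x - (round y : ℝ)| ≤ |x - y| + |y - round y| := abs_sub_le _ _ _
  unfold nint at h ⊢
  linarith

lemma nint_pos_of_irrational {x : ℝ} (hx : Irrational x) : 0 < nint x :=
  abs_pos.2 (sub_ne_zero.2 (hx.ne_int _))

lemma scaledDist_nonneg (α β : ℝ) (q : ℕ) : 0 ≤ scaledDist α β q :=
  mul_nonneg (Nat.cast_nonneg _) (nint_nonneg _)

lemma scaledDist_add_intCast (α β : ℝ) (n : ℤ) (q : ℕ) :
    scaledDist α (β + n) q = scaledDist α β q := by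
  unfold scaledDist
  rw [← nint_add_intCast (q * α - (β + n)) n]
  ring_nf

lemma scaledDist_sub_le_shift (α β : ℝ) {m q : ℕ} (h : m ≤ q) :
    scaledDist α β (q - m) ≤ scaledDist α (β + m * α) q := by
  unfold scaledDist
  have e : ((q - m : ℕ) : ℝ) * α - β = q * α - (β + m * α) := by
    push_cast [Nat.cast_sub h]; ring
  rw [e]
  have : ((q - m : ℕ) : ℝ) ≤ q := by exact_mod_cast Nat.sub_le q m
  exact mul_le_mul_of_nonneg_right this (nint_nonneg _)

lemma scaledDist_le_add (α β β' : ℝ) (q : ℕ) :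
    scaledDist α β q ≤ scaledDist α β' q + q * |β' - β| := by
  unfold scaledDist
  have h := nint_le_add_abs_sub (q * α - β) (q * α - β')
  have e : (q : ℝ) * α - β - (q * α - β') = β' - β := by ring
  rw [e] at h
  rw [← mul_add]
  exact mul_le_mul_of_nonneg_left h (Nat.cast_nonneg _)

lemma gm_irrational {α : ℝ} (hα : Irrational α) (n : ℕ) : Irrational (gm α n) := by
  induction n with
  | zero =>
    have : Irrational (α - (⌊α⌋ : ℤ)) := hα.sub_intCast _
    exact this
  | succ n ih =>
    have : Irrational ((gm α n)⁻¹ - (⌊(gm α n)⁻¹⌋ : ℤ)) := ih.inv.sub_intCast _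
    exact this

lemma gm_pos {α : ℝ} (hα : Irrational α) (n : ℕ) : 0 < gm α n := by
  refine lt_of_le_of_ne ?_ (gm_irrational hα n).ne_zero.symm
  cases n <;> exact Int.fract_nonneg _

lemma gm_lt_one (α : ℝ) (n : ℕ) : gm α n < 1 := by
  cases n <;> exact Int.fract_lt_one _

/-- Two consecutive convergents `p' / q'` and `p / q`, whose signed errors `s (qα - p)` and
`s (p' - q'α)` have ratio `gm α n`. -/
lemma exists_consecutive_convergents {α : ℝ} (hα : Irrational α) (n : ℕ) :
    ∃ (s q q' p p' : ℤ), s * s = 1 ∧ 0 < q ∧ 0 ≤ q' ∧ s * (q * p' - q' * p) = 1 ∧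
      0 < s * (p' - q' * α) ∧ s * (q * α - p) = gm α n * (s * (p' - q' * α)) := by
  induction n with
  | zero =>
    refine ⟨1, 1, 0, ⌊α⌋, 1, by norm_num, by norm_num, by norm_num, by norm_num, by norm_num, ?_⟩
    have h : gm α 0 = α - ⌊α⌋ := rfl
    rw [h]
    push_cast
    ring
  | succ n ih =>
    obtain ⟨s, q, q', p, p', hs, hq, hq', hd, hpos, he⟩ := ih
    have hg := gm_pos hα n
    have ha : 1 ≤ ⌊(gm α n)⁻¹⌋ := by
      rw [Int.le_floor]
      simpa using (one_le_inv₀ hg).2 (gm_lt_one α n).le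
    refine ⟨-s, ⌊(gm α n)⁻¹⌋ * q + q', q, ⌊(gm α n)⁻¹⌋ * p + p', p, by linarith, by nlinarith,
      hq.le, by linear_combination hd, ?_, ?_⟩
    · have : 0 < gm α n * (s * (p' - q' * α)) := mul_pos hg hpos
      push_cast
      linarith
    · have hf : gm α (n + 1) = (gm α n)⁻¹ - ⌊(gm α n)⁻¹⌋ := rfl
      have hi : (gm α n)⁻¹ * gm α n = 1 := inv_mul_cancel₀ hg.ne'
      rw [hf]
      push_cast
      linear_combination -(gm α n)⁻¹ * he - (s * (p' - q' * α)) * hi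

lemma exists_isGoodApprox {α : ℝ} (hα : Irrational α)
    (hub : ∀ B : ℤ, ∃ n : ℕ, B < ⌊(gm α n)⁻¹⌋) {ε : ℝ} (hε : 0 < ε) :
    ∃ N p, IsGoodApprox α ε N p := by
  obtain ⟨n, hn⟩ := hub ⌈ε⁻¹⌉
  obtain ⟨s, q, q', p, p', hs, hq, hq', hd, hpos, he⟩ := exists_consecutive_convergents hα n
  lift q to ℕ using hq.le
  have hg := gm_pos hα n
  have hge : gm α n ≤ ε := by
    have h1 : ε⁻¹ ≤ (gm α n)⁻¹ := by
      have := (Int.le_ceil ε⁻¹).trans (Int.cast_le.2 hn.le)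
      exact this.trans (Int.floor_le _)
    exact (inv_le_inv₀ hε hg).1 h1
  have hqR : (0 : ℝ) < q := by exact_mod_cast hq
  have hq'R : (0 : ℝ) ≤ q' := by exact_mod_cast hq'
  refine ⟨q, p, by exact_mod_cast hq, ⟨-s * q', s * p', by linear_combination hd⟩, ?_⟩
  have hsR : (s : ℝ) * s = 1 := by exact_mod_cast hs
  have habs : |(s : ℝ)| = 1 := by
    have h := abs_mul_abs_self (s : ℝ)
    rw [hsR] at h
    nlinarith [abs_nonneg (s : ℝ)]
  have hdR : (s : ℝ) * (q * p' - q' * p) = 1 := by exact_mod_cast hd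
  simp only [Int.cast_natCast] at he
  have h0 : 0 < gm α n * (s * (p' - q' * α)) := mul_pos hg hpos
  have h1 : |(q : ℝ) * α - p| = gm α n * (s * (p' - q' * α)) := by
    rw [← abs_of_pos h0, ← he, abs_mul, habs, one_mul]
  have h2 : (q : ℝ) * (s * (p' - q' * α)) ≤ 1 := by
    have : (q : ℝ) * (s * (p' - q' * α)) = 1 - q' * (s * (q * α - p)) := by
      linear_combination hdR
    rw [this, he]
    nlinarith
  rw [h1, le_div_iff₀ hqR]
  nlinarith

lemma exists_isGoodApprox_ge {α : ℝ} (hα : Irrational α)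
    (hub : ∀ B : ℤ, ∃ n : ℕ, B < ⌊(gm α n)⁻¹⌋) {ε : ℝ} (hε : 0 < ε) (N₀ : ℕ) :
    ∃ N p, N₀ ≤ N ∧ IsGoodApprox α ε N p := by
  obtain ⟨c, hc, hcN⟩ : ∃ c > 0, ∀ n : ℕ, 0 < n → n < N₀ → c < (n : ℝ) * nint (n * α) := by
    induction N₀ with
    | zero => exact ⟨1, one_pos, fun n _ h => by omega⟩
    | succ k ih =>
      obtain ⟨c, hc, h⟩ := ih
      rcases Nat.eq_zero_or_pos k with rfl | hk
      · exact ⟨1, one_pos, fun n _ h => by omega⟩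
      have hkR : (0 : ℝ) < k := by exact_mod_cast hk
      have hp : 0 < (k : ℝ) * nint (k * α) :=
        mul_pos hkR (nint_pos_of_irrational (hα.natCast_mul hk.ne'))
      refine ⟨min c ((k : ℝ) * nint (k * α) / 2), by positivity, fun n hn hnk => ?_⟩
      rcases Nat.lt_succ_iff_lt_or_eq.1 hnk with hlt | rfl
      · exact (min_le_left _ _).trans_lt (h n hn hlt)
      · exact (min_le_right _ _).trans_lt (by linarith)
  obtain ⟨N, p, hN, hcop, hle⟩ := exists_isGoodApprox hα hub (lt_min hε hc)
  have hNR : (0 : ℝ) < N := by exact_mod_cast hN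
  refine ⟨N, p, ?_, hN, hcop, hle.trans (by gcongr; exact min_le_left _ _)⟩
  by_contra! hlt
  have h1 := hcN N hN hlt
  have h2 : nint (N * α) ≤ c / N :=
    (nint_le_abs_sub _ p).trans (hle.trans (by gcongr; exact min_le_right _ _))
  rw [le_div_iff₀ hNR] at h2
  linarith

/-- Multiples of `α` over a full period of `N` consecutive integers come close to every point
which is close to `(1/N)ℤ`. -/
lemma IsGoodApprox.exists_nint_le {α ε : ℝ} {N : ℕ} {p : ℤ} (h : IsGoodApprox α ε N p)
    (y : ℝ) {c : ℕ} (hc : c ≤ N) :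
    ∃ m : ℕ, c ≤ m ∧ m < c + N ∧ nint (m * α - y) ≤ (nint (N * y) + 2 * ε) / N := by
  obtain ⟨hN, ⟨u, v, huv⟩, hle⟩ := h
  have hNR : (0 : ℝ) < N := by exact_mod_cast hN
  have hNZ : (0 : ℤ) < N := by exact_mod_cast hN
  set j := round (N * y) with hj
  have hr0 := Int.emod_nonneg (j * u - c) hNZ.ne'
  have hr1 := Int.emod_lt_of_pos (j * u - c) hNZ
  have hr2 := Int.emod_add_mul_ediv (j * u - c) N
  obtain ⟨r, hr⟩ := Int.eq_ofNat_of_zero_le hr0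
  rw [hr] at hr1 hr2
  have hrN : r < N := by exact_mod_cast hr1
  refine ⟨c + r, by omega, by omega, ?_⟩
  set w := (j * u - c) / (N : ℤ)
  have key : ((c + r : ℕ) : ℤ) * p = j + N * (-(j * v) - w * p) := by
    push_cast
    linear_combination p * hr2 + j * huv
  have keyR : ((c + r : ℕ) : ℝ) * p = j + N * ((-(j * v) - w * p : ℤ) : ℝ) := by
    exact_mod_cast key
  refine (nint_le_abs_sub _ (-(j * v) - w * p)).trans ?_
  set t : ℤ := -(j * v) - w * p
  have hm : ((c + r : ℕ) : ℝ) ≤ 2 * N := by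
    have : c + r ≤ 2 * N := by omega
    exact_mod_cast this
  set m : ℕ := c + r
  rw [le_div_iff₀ hNR, ← abs_of_pos hNR, ← abs_mul, abs_of_pos hNR]
  have e : ((m : ℝ) * α - y - t) * N = m * (N * α - p) - (N * y - j) := by
    linear_combination keyR
  rw [e]
  have h1 : |(m : ℝ) * (N * α - p)| ≤ 2 * ε := by
    rw [abs_mul, Nat.abs_cast]
    calc (m : ℝ) * |N * α - p| ≤ (2 * N) * (ε / N) := by gcongr
      _ = 2 * ε := by field_simp
  have h2 : |(N : ℝ) * y - j| = nint (N * y) := rfl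
  calc _ ≤ |(m : ℝ) * (N * α - p)| + |(N : ℝ) * y - j| := abs_sub _ _
    _ ≤ _ := by linarith

lemma frequently_scaledDist_le {α : ℝ} (hα : Irrational α)
    (hub : ∀ B : ℤ, ∃ n : ℕ, B < ⌊(gm α n)⁻¹⌋) (β : ℝ) :
    ∃ᶠ q in atTop, scaledDist α β q ≤ 5 := by
  rw [frequently_atTop]
  intro Q
  obtain ⟨N, p, hQN, h⟩ := exists_isGoodApprox_ge hα hub one_pos Q
  obtain ⟨m, h1, h2, h3⟩ := h.exists_nint_le β le_rfl
  have hNR : (0 : ℝ) < N := by exact_mod_cast h.1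
  refine ⟨m, hQN.trans h1, ?_⟩
  have h4 : nint (N * β) ≤ 1 / 2 := abs_sub_round _
  have hm : (m : ℝ) ≤ 2 * N := by
    have : m ≤ 2 * N := by omega
    exact_mod_cast this
  calc scaledDist α β m ≤ (2 * N) * ((1 / 2 + 2 * 1) / N) := by
        unfold scaledDist
        exact mul_le_mul hm (h3.trans (by gcongr)) (nint_nonneg _) (by positivity)
    _ = 5 := by field_simp; norm_num

lemma isBoundedUnder_scaledDist (α β : ℝ) :
    IsBoundedUnder (· ≥ ·) atTop (scaledDist α β) :=
  isBoundedUnder_of ⟨0, fun q => scaledDist_nonneg α β q⟩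

lemma isCoboundedUnder_scaledDist {α : ℝ} (hα : Irrational α)
    (hub : ∀ B : ℤ, ∃ n : ℕ, B < ⌊(gm α n)⁻¹⌋) (β : ℝ) :
    IsCoboundedUnder (· ≥ ·) atTop (scaledDist α β) :=
  IsCoboundedUnder.of_frequently_le (frequently_scaledDist_le hα hub β)

lemma Mplus_le_five {α : ℝ} (hα : Irrational α)
    (hub : ∀ B : ℤ, ∃ n : ℕ, B < ⌊(gm α n)⁻¹⌋) (β : ℝ) : Mplus α β ≤ 5 :=
  liminf_le_of_frequently_le (frequently_scaledDist_le hα hub β) (isBoundedUnder_scaledDist α β)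

lemma Mplus_nonneg {α : ℝ} (hα : Irrational α)
    (hub : ∀ B : ℤ, ∃ n : ℕ, B < ⌊(gm α n)⁻¹⌋) (β : ℝ) : 0 ≤ Mplus α β :=
  le_liminf_of_le (isCoboundedUnder_scaledDist hα hub β)
    (Eventually.of_forall fun q => scaledDist_nonneg α β q)

/-- Frequently small and eventually almost large scaled distances pin down `Mplus`. -/
lemma Mplus_eq_of_forall {α β x : ℝ} (hle : ∀ c < x, ∀ᶠ q in atTop, c ≤ scaledDist α β q)
    (hge : ∀ c > x, ∃ᶠ q in atTop, scaledDist α β q ≤ c) : Mplus α β = x := by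
  refine le_antisymm (le_of_forall_gt_imp_ge_of_dense fun c hc => ?_)
    (le_of_forall_lt_imp_le_of_dense fun c hc => ?_)
  · exact liminf_le_of_frequently_le (hge c hc) (isBoundedUnder_scaledDist α β)
  · exact le_liminf_of_le (IsCoboundedUnder.of_frequently_le (hge (x + 1) (by linarith))) (hle c hc)

/-- Successive small modifications of `β` produce a point with a prescribed value of `Mplus`. -/
lemma exists_Mplus_eq_of_step {α x : ℝ} {A : ℕ → Set ℝ} {η : ℕ → ℝ} (hη : ∀ i, 0 < η i)
    (hη0 : Tendsto η atTop (nhds 0)) (h0 : (A 0).Nonempty)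
    (hstep : ∀ i, ∀ β ∈ A i, ∃ Q₀ : ℕ, ∀ Q ≥ Q₀, ∀ δ > 0, ∃ β' ∈ A (i + 1), |β' - β| ≤ δ ∧
      (∀ q ≥ Q, x - η i ≤ scaledDist α β' q) ∧ ∃ q ≥ Q, scaledDist α β' q ≤ x + η i) :
    ∃ β, Mplus α β = x := by
  let Good : ℕ × ℝ × ℕ × ℝ → Prop := fun s => s.2.1 ∈ A s.1 ∧ 0 < s.2.2.2 ∧
    ∀ δ > 0, ∃ β' ∈ A (s.1 + 1), |β' - s.2.1| ≤ δ ∧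
      (∀ q ≥ s.2.2.1, x - η s.1 ≤ scaledDist α β' q) ∧
      ∃ q ≥ s.2.2.1, scaledDist α β' q ≤ x + η s.1
  let R : {s // Good s} → {s // Good s} → Prop := fun s t => t.1.1 = s.1.1 + 1 ∧
    |t.1.2.1 - s.1.2.1| ≤ s.1.2.2.2 ∧ s.1.2.2.1 < t.1.2.2.1 ∧
    t.1.2.2.2 ≤ s.1.2.2.2 / 2 ∧ t.1.2.2.1 * (2 * t.1.2.2.2) ≤ η s.1.1 ∧
    (∀ q ≥ s.1.2.2.1, x - η s.1.1 ≤ scaledDist α t.1.2.1 q) ∧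
    ∃ q ≥ s.1.2.2.1, q < t.1.2.2.1 ∧ scaledDist α t.1.2.1 q ≤ x + η s.1.1
  have hR : ∀ s, ∃ t, R s t := by
    rintro ⟨⟨i, β, Q, δ⟩, hβ, hδ, hs⟩
    obtain ⟨β', hβ', hd, hlow, q, hqQ, hup⟩ := hs δ hδ
    obtain ⟨Q₀, hQ₀⟩ := hstep (i + 1) β' hβ'
    dsimp only at hβ hδ hβ' hd hlow hqQ hup
    set Q' := max Q₀ (max (Q + 1) (q + 1)) with hQ'
    have h1 : Q + 1 ≤ Q' := (le_max_left _ _).trans (le_max_right _ _)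
    have h2 : q + 1 ≤ Q' := (le_max_right _ _).trans (le_max_right _ _)
    have hQR : (0 : ℝ) < Q' := by exact_mod_cast (show 0 < Q' by omega)
    refine ⟨⟨(i + 1, β', Q', min (δ / 2) (η i / (2 * Q'))), hβ', ?_, hQ₀ Q' (le_max_left _ _)⟩,
      rfl, hd, by dsimp only; omega, min_le_left _ _, ?_, hlow, q, hqQ, by dsimp only; omega, hup⟩
    · exact lt_min (half_pos hδ) (div_pos (hη i) (by positivity))
    · dsimp only
      calc (Q' : ℝ) * (2 * min (δ / 2) (η i / (2 * Q'))) ≤ Q' * (2 * (η i / (2 * Q'))) := by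
            gcongr; exact min_le_right _ _
        _ = η i := by field_simp
  choose nxt hnxt using hR
  obtain ⟨β₀, hβ₀⟩ := h0
  obtain ⟨Q₀, hQ₀⟩ := hstep 0 β₀ hβ₀
  let s : ℕ → {s // Good s} := fun n =>
    nxt^[n] ⟨(0, β₀, Q₀, 1), hβ₀, one_pos, hQ₀ Q₀ le_rfl⟩
  have hs : ∀ n, R (s n) (s (n + 1)) := fun n => by
    have : s (n + 1) = nxt (s n) := Function.iterate_succ_apply' _ _ _
    rw [this]
    exact hnxt _
  have hidx : ∀ n, (s n).1.1 = n := fun n => by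
    induction n with
    | zero => rfl
    | succ n ih => rw [(hs n).1, ih]
  set b : ℕ → ℝ := fun n => (s n).1.2.1 with hb
  set Q : ℕ → ℕ := fun n => (s n).1.2.2.1 with hQ
  set δ : ℕ → ℝ := fun n => (s n).1.2.2.2 with hδ
  have hδpos : ∀ n, 0 < δ n := fun n => (s n).2.2.1
  have hQmono : StrictMono Q := strictMono_nat_of_lt_succ fun n => (hs n).2.2.1
  obtain ⟨B, hB⟩ : (⋂ n, Metric.closedBall (b n) (2 * δ n)).Nonempty := by
    refine IsCompact.nonempty_iInter_of_sequence_nonempty_isCompact_isClosed _ (fun n => ?_)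
      (fun n => ?_) (isCompact_closedBall _ _) fun n => Metric.isClosed_closedBall
    · refine Metric.closedBall_subset_closedBall' ?_
      have h1 : |b (n + 1) - b n| ≤ δ n := (hs n).2.1
      have h2 : δ (n + 1) ≤ δ n / 2 := (hs n).2.2.2.1
      rw [Real.dist_eq]
      linarith
    · exact Metric.nonempty_closedBall.2 (by linarith [hδpos n])
  have hclose : ∀ n, |B - b n| ≤ 2 * δ n := fun n => by
    have := Set.mem_iInter.1 hB n
    rwa [Metric.mem_closedBall, Real.dist_eq] at this
  have hpert : ∀ n q, q < Q (n + 1) → (q : ℝ) * |B - b (n + 1)| ≤ η n := fun n q hq => by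
    have h1 : (Q (n + 1) : ℝ) * (2 * δ (n + 1)) ≤ η n := by
      have := (hs n).2.2.2.2.1
      rwa [hidx n] at this
    have h2 : (q : ℝ) ≤ Q (n + 1) := by exact_mod_cast hq.le
    exact (mul_le_mul h2 (hclose (n + 1)) (abs_nonneg _) (Nat.cast_nonneg _)).trans h1
  refine ⟨B, Mplus_eq_of_forall (fun c hc => ?_) (fun c hc => ?_)⟩
  · obtain ⟨n₀, hn₀⟩ := eventually_atTop.1
      (hη0.eventually (gt_mem_nhds (show (0 : ℝ) < (x - c) / 2 by linarith)))
    filter_upwards [eventually_ge_atTop (Q n₀)] with q hq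
    obtain ⟨n, hn, hq1, hq2⟩ : ∃ n ≥ n₀, Q n ≤ q ∧ q < Q (n + 1) := by
      have hex : ∃ n, q < Q (n + 1) := ⟨q, hQmono.le_apply.trans_lt (hQmono q.lt_succ_self)⟩
      classical
      have hspec := Nat.find_spec hex
      refine ⟨Nat.find hex, ?_, ?_, hspec⟩
      · by_contra! hlt
        exact absurd (hq.trans_lt hspec) (not_lt.2 (hQmono.monotone hlt))
      · rcases hk : Nat.find hex with _ | k
        · exact (hQmono.monotone (Nat.zero_le n₀)).trans hq
        · exact not_lt.1 (Nat.find_min hex (show k < Nat.find hex by omega))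
    have h1 : x - η n ≤ scaledDist α (b (n + 1)) q := by
      have := (hs n).2.2.2.2.2.1 q hq1
      rwa [hidx n] at this
    have h2 := scaledDist_le_add α (b (n + 1)) B q
    have h3 := hpert n q hq2
    have h4 := hn₀ n hn
    linarith
  · obtain ⟨n₀, hn₀⟩ := eventually_atTop.1
      (hη0.eventually (gt_mem_nhds (show (0 : ℝ) < (c - x) / 2 by linarith)))
    rw [frequently_atTop]
    intro K
    set n := max n₀ K
    obtain ⟨q, hq1, hq2, hup⟩ := (hs n).2.2.2.2.2.2
    rw [hidx n] at hup
    refine ⟨q, ((le_max_right _ _).trans hQmono.le_apply).trans hq1, ?_⟩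
    have h2 := scaledDist_le_add α B (b (n + 1)) q
    have h3 := hpert n q hq2
    rw [abs_sub_comm] at h3
    have h4 := hn₀ n (le_max_left _ _)
    have h5 : scaledDist α (b (n + 1)) q ≤ x + η n := hup
    linarith

lemma exists_Mplus_eq_zero {α : ℝ} (hα : Irrational α)
    (hub : ∀ B : ℤ, ∃ n : ℕ, B < ⌊(gm α n)⁻¹⌋) : ∃ β, Mplus α β = 0 := by
  refine ⟨0, Mplus_eq_of_forall (fun c hc => Eventually.of_forall fun q =>
    hc.le.trans (scaledDist_nonneg _ _ _)) fun c hc => frequently_atTop.2 fun K => ?_⟩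
  obtain ⟨N, p, hK, hN, -, hle⟩ := exists_isGoodApprox_ge hα hub hc K
  refine ⟨N, hK, ?_⟩
  have hNR : (0 : ℝ) < N := by exact_mod_cast hN
  rw [le_div_iff₀ hNR] at hle
  have h := nint_le_abs_sub (N * α) p
  unfold scaledDist
  rw [sub_zero]
  nlinarith

/-- Every `β` admits a multiple `k N` with `q‖(q - kN)α - β‖` small for some `q` of size `N`, the
points `β + iNα`, `i ≤ k`, being close to `β` modulo one. -/
lemma IsGoodApprox.exists_hit {α ε : ℝ} (hα : Irrational α) {N : ℕ} {p : ℤ}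
    (h : IsGoodApprox α ε N p) (hε : ε ≤ 1 / 4) (β : ℝ) :
    ∃ k q : ℕ, N ≤ q ∧ k * |N * α - p| ≤ 3 / N ∧
      scaledDist α (β + k * (N * α - p)) q ≤ 2 * ε := by
  have hNR : (0 : ℝ) < N := by exact_mod_cast h.1
  obtain ⟨σ, hσ, hd⟩ : ∃ σ : ℝ, σ * σ = 1 ∧ N * α - p = σ * |N * α - p| := by
    rcases le_total 0 (N * α - p) with h0 | h0
    · exact ⟨1, by norm_num, by rw [abs_of_nonneg h0]; ring⟩
    · exact ⟨-1, by norm_num, by rw [abs_of_nonpos h0]; ring⟩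
  have hdpos : 0 < |N * α - p| :=
    abs_pos.2 (sub_ne_zero.2 ((hα.natCast_mul h.1.ne').ne_int p))
  have hdle := h.2.2
  obtain ⟨q, hq1, hq2, hq3⟩ := h.exists_nint_le (β + σ * (2 / N)) le_rfl
  set d := |N * α - p|
  have hq : (q : ℝ) ≤ 2 * N := by
    have : q ≤ 2 * N := by omega
    exact_mod_cast this
  have hn : nint (N * (β + σ * (2 / N))) ≤ 1 / 2 := abs_sub_round _
  have he : |q * α - (β + σ * (2 / N)) - round (q * α - (β + σ * (2 / N)))| ≤ 1 / N :=
    hq3.trans (by gcongr; linarith)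
  set n := round (q * α - (β + σ * (2 / N)))
  set e := q * α - (β + σ * (2 / N)) - n with hedef
  have hσabs : |σ| = 1 := by
    have h := abs_mul_abs_self σ
    rw [hσ] at h
    nlinarith [abs_nonneg σ]
  have hσe : |σ * e| ≤ 1 / N := by rw [abs_mul, hσabs, one_mul]; exact he
  set τ := 2 / N + σ * e with hτ
  have h2N : (2 : ℝ) / N = 2 * (1 / N) := by ring
  have h3N : (3 : ℝ) / N = 3 * (1 / N) := by ring
  have hpos : (0 : ℝ) < 1 / N := by positivity
  obtain ⟨hb1, hb2⟩ := abs_le.1 hσe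
  have hτ0 : 0 ≤ τ := by linarith
  have hk1 : (⌊τ / d⌋₊ : ℝ) * d ≤ τ := by
    rw [← le_div_iff₀ hdpos]; exact Nat.floor_le (by positivity)
  have hk2 : τ < ((⌊τ / d⌋₊ : ℝ) + 1) * d := by
    rw [← div_lt_iff₀ hdpos]; exact Nat.lt_floor_add_one _
  refine ⟨⌊τ / d⌋₊, q, hq1, by linarith, ?_⟩
  set k : ℝ := (⌊τ / d⌋₊ : ℝ)
  have hn2 : nint (q * α - (β + k * (N * α - p))) ≤ d := by
    refine (nint_le_abs_sub _ n).trans ?_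
    have e1 : q * α - (β + k * (N * α - p)) - n = σ * (τ - k * d) := by
      rw [hd, hτ]
      linear_combination (-hedef) - e * hσ
    rw [e1, abs_mul, hσabs, one_mul, abs_le]
    constructor <;> linarith
  calc scaledDist α (β + k * (N * α - p)) q ≤ (2 * N) * (ε / N) :=
        mul_le_mul hq (hn2.trans hdle) (nint_nonneg _) (by positivity)
    _ = 2 * ε := by field_simp

lemma exists_Mplus_eq_of_lt {α : ℝ} (hα : Irrational α)
    (hub : ∀ B : ℤ, ∃ n : ℕ, B < ⌊(gm α n)⁻¹⌋) {x β₀ : ℝ} (hx : 0 < x) (hβ₀ : x < Mplus α β₀) :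
    ∃ β, Mplus α β = x := by
  obtain ⟨y, hxy, hy⟩ := exists_between hβ₀
  refine exists_Mplus_eq_of_step (A := fun _ => {β | ∀ᶠ q in atTop, y ≤ scaledDist α β q})
    (η := fun i => 1 / ((i : ℝ) + 1)) (fun i => by positivity)
    tendsto_one_div_add_atTop_nhds_zero_nat
    ⟨β₀, (eventually_lt_of_lt_liminf hy (isBoundedUnder_scaledDist α β₀)).mono
      fun q hq => le_of_lt hq⟩ fun i β hβ => ?_
  obtain ⟨Q₀, hQ₀⟩ := eventually_atTop.1 hβ
  refine ⟨Q₀, fun Q hQ δ hδ => ?_⟩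
  have hηi : 0 < 1 / ((i : ℝ) + 1) := by positivity
  set η := 1 / ((i : ℝ) + 1)
  set ε := min (1 / 4) (min (x / 4) (η / 2))
  have hε0 : 0 < ε := by positivity
  have hε1 : ε ≤ 1 / 4 := min_le_left _ _
  have hε2 : ε ≤ x / 4 := (min_le_right _ _).trans (min_le_left _ _)
  have hε3 : ε ≤ η / 2 := (min_le_right _ _).trans (min_le_right _ _)
  obtain ⟨N, p, hN, hgood⟩ := exists_isGoodApprox_ge hα hub hε0 (max Q ⌈3 / δ⌉₊)
  have hNR : (0 : ℝ) < N := by exact_mod_cast hgood.1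
  have hQN : Q ≤ N := (le_max_left _ _).trans hN
  have hδN : 3 / (N : ℝ) ≤ δ := by
    have : 3 / δ ≤ N := (Nat.le_ceil _).trans (by exact_mod_cast (le_max_right _ _).trans hN)
    rw [div_le_iff₀ hδ] at this
    rw [div_le_iff₀ hNR]
    linarith
  have hshift : ∀ k q : ℕ, scaledDist α (β + k * (N * α - p)) q =
      scaledDist α (β + (k * N : ℕ) * α) q := fun k q => by
    rw [← scaledDist_add_intCast α (β + k * (N * α - p)) (k * p)]
    push_cast
    ring_nf
  obtain ⟨k₁, q₁, hq₁, hk₁, hs₁⟩ := hgood.exists_hit hα hε1 β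
  have hex : ∃ k : ℕ, ∃ q ≥ Q, scaledDist α (β + k * (N * α - p)) q < x :=
    ⟨k₁, q₁, hQN.trans hq₁, by linarith⟩
  classical
  set k := Nat.find hex with hk
  have hkk₁ : k ≤ k₁ := Nat.find_min' hex ⟨q₁, hQN.trans hq₁, by linarith⟩
  obtain ⟨q₂, hq₂, hlt⟩ := Nat.find_spec hex
  rw [← hk] at hlt
  have hkpos : k ≠ 0 := fun h0 => by
    rw [h0] at hlt
    have := hQ₀ q₂ (hQ.trans hq₂)
    simp only [Nat.cast_zero, zero_mul, add_zero] at hlt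
    linarith
  obtain ⟨l, hl⟩ := Nat.exists_eq_succ_of_ne_zero hkpos
  have hprev : ∀ q ≥ Q, x ≤ scaledDist α (β + l * (N * α - p)) q := fun q hq => by
    by_contra! hc
    exact Nat.find_min hex (show l < Nat.find hex by omega) ⟨q, hq, hc⟩
  refine ⟨β + k * (N * α - p), ?_, ?_, fun q hq => ?_, q₂, hq₂, by linarith⟩
  · filter_upwards [eventually_ge_atTop (k * N + Q₀)] with q hq
    rw [hshift]
    exact (hQ₀ _ (by omega)).trans (scaledDist_sub_le_shift α β (by omega))
  · rw [add_sub_cancel_left, abs_mul, Nat.abs_cast]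
    have : (k : ℝ) ≤ k₁ := by exact_mod_cast hkk₁
    exact ((mul_le_mul_of_nonneg_right this (abs_nonneg _)).trans hk₁).trans hδN
  · have hkl : (k : ℝ) = l + 1 := by rw [hl]; push_cast; ring
    rcases lt_or_ge q (Q + N) with hqN | hqN
    · have h1 := scaledDist_le_add α (β + l * (N * α - p)) (β + k * (N * α - p)) q
      have e1 : β + k * (N * α - p) - (β + l * (N * α - p)) = N * α - p := by rw [hkl]; ring
      rw [e1] at h1
      have h2 : (q : ℝ) * |N * α - p| ≤ 2 * ε := by
        have hq2 : (q : ℝ) ≤ 2 * N := by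
          have : q ≤ 2 * N := by omega
          exact_mod_cast this
        calc (q : ℝ) * |N * α - p| ≤ (2 * N) * (ε / N) :=
              mul_le_mul hq2 hgood.2.2 (abs_nonneg _) (by positivity)
          _ = 2 * ε := by field_simp
      have h3 := hprev q hq
      linarith
    · have h1 := hprev (q - N) (by omega)
      have h2 := scaledDist_sub_le_shift α (β + l * (N * α - p)) (show N ≤ q by omega)
      have e1 : β + k * (N * α - p) = β + l * (N * α - p) + N * α + (-p : ℤ) := by
        rw [hkl]; push_cast; ring
      rw [e1, scaledDist_add_intCast]
      linarith

/-- The supremum of `Mplus α` is attained. -/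
lemma exists_Mplus_eq_of_isLUB {α M : ℝ} (hα : Irrational α)
    (hub : ∀ B : ℤ, ∃ n : ℕ, B < ⌊(gm α n)⁻¹⌋) (hM : IsLUB (Set.range (Mplus α)) M) :
    ∃ β, Mplus α β = M := by
  have hgood : ∀ k : ℕ, ∃ N p, k ≤ N ∧ IsGoodApprox α (1 / ((k : ℝ) + 1)) N p := fun k =>
    exists_isGoodApprox_ge hα hub (by positivity) k
  choose N p hkN hNp using hgood
  have hN1 : ∀ k, (1 : ℝ) ≤ N k := fun k => by exact_mod_cast (hNp k).1
  have herr : ∀ k, |N k * α - p k| ≤ 1 / ((k : ℝ) + 1) := fun k =>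
    (hNp k).2.2.trans (div_le_self (by positivity) (hN1 k))
  have hU : (hyperfilter ℕ : Filter ℕ) ≤ atTop := Nat.hyperfilter_le_atTop
  have herr0 : Tendsto (fun k => N k * α - p k) (hyperfilter ℕ) (nhds 0) :=
    (squeeze_zero_norm herr tendsto_one_div_add_atTop_nhds_zero_nat).mono_left hU
  -- the limiting position of `β` relative to the grids `(1 / N k)ℤ`
  have hlim : ∀ β : ℝ, ∃ θ : UnitAddCircle,
      Tendsto (fun k => ((N k * β : ℝ) : UnitAddCircle)) (hyperfilter ℕ) (nhds θ) := fun β =>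
    ⟨_, ((hyperfilter ℕ).map fun k => ((N k * β : ℝ) : UnitAddCircle)).le_nhds_lim⟩
  choose φ hφ using hlim
  have hφshift : ∀ (γ : ℝ) (m : ℕ) (n : ℤ), φ (γ + m * α + n) = φ γ := fun γ m n => by
    have h1 : Tendsto (fun k => ((m * (N k * α - p k) : ℝ) : UnitAddCircle)) (hyperfilter ℕ)
        (nhds ((m * 0 : ℝ) : UnitAddCircle)) :=
      ((AddCircle.continuous_mk' (1 : ℝ)).tendsto _).comp (herr0.const_mul (m : ℝ))
    have h2 := (hφ γ).add h1
    rw [mul_zero, AddCircle.coe_zero, add_zero] at h2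
    refine tendsto_nhds_unique ((hφ _).congr fun k => ?_) h2
    rw [← AddCircle.coe_add, ← sub_eq_zero, ← AddCircle.coe_sub, AddCircle.coe_eq_zero_iff]
    refine ⟨m * p k + N k * n, ?_⟩
    simp only [zsmul_eq_mul]
    push_cast
    ring
  set η : ℕ → ℝ := fun i => 1 / ((i : ℝ) + 1) with hη
  have hηpos : ∀ i, 0 < η i := fun i => by simp only [hη]; positivity
  have hηanti : Antitone η := fun i j hij => by
    simp only [hη]
    gcongr
  have hη0 : Tendsto η atTop (nhds 0) := tendsto_one_div_add_atTop_nhds_zero_nat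
  have hγ : ∀ i, ∃ γ, M - η i / 2 < Mplus α γ := fun i => by
    obtain ⟨_, ⟨γ, rfl⟩, h, -⟩ := hM.exists_between (sub_lt_self M (half_pos (hηpos i)))
    exact ⟨γ, h⟩
  choose γ hγM using hγ
  obtain ⟨θ, -, s, hs, hθ⟩ := isCompact_univ.tendsto_subseq fun i => Set.mem_univ (φ (γ i))
  let A : ℕ → Set ℝ := fun i =>
    {β | (∀ᶠ q in atTop, M - η i / 2 ≤ scaledDist α β q) ∧ dist (φ β) θ < η i / 16}
  have hA : ∀ i, (A i).Nonempty := fun i => by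
    obtain ⟨j, hj, hij⟩ := ((hθ.eventually (Metric.ball_mem_nhds θ
      (show 0 < η i / 16 by linarith [hηpos i]))).and (eventually_ge_atTop i)).exists
    refine ⟨γ (s j), ?_, hj⟩
    have h1 := hηanti (hij.trans (hs.le_apply (x := j)))
    filter_upwards [eventually_lt_of_lt_liminf (hγM (s j)) (isBoundedUnder_scaledDist α _)]
      with q hq
    have hq' : M - η (s j) / 2 < scaledDist α (γ (s j)) q := hq
    linarith
  refine exists_Mplus_eq_of_step (A := A) hηpos hη0 (hA 0) fun i β hβ => ?_
  obtain ⟨Q₀, hQ₀⟩ := eventually_atTop.1 hβ.1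
  refine ⟨Q₀, fun Q hQ δ hδ => ?_⟩
  obtain ⟨γ', hγ'⟩ := hA (i + 1)
  obtain ⟨Q₁, hQ₁⟩ := eventually_atTop.1 hγ'.1
  have hηi := hηanti i.le_succ
  have hpos := hηpos i
  have hdist : Tendsto (fun k => dist ((N k * (β - γ') : ℝ) : UnitAddCircle) 0) (hyperfilter ℕ)
      (nhds (dist (φ β - φ γ') 0)) := by
    refine Tendsto.dist (((hφ β).sub (hφ γ')).congr fun k => ?_) tendsto_const_nhds
    rw [mul_sub, AddCircle.coe_sub]
  have hlt : dist (φ β - φ γ') 0 < η i / 8 := by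
    rw [dist_zero_right, ← dist_eq_norm]
    have h1 := hβ.2
    have h2 := hγ'.2
    have h3 := dist_triangle_right (φ β) (φ γ') θ
    linarith
  obtain ⟨k, ⟨⟨hk1, hk2⟩, hk3⟩, hk4⟩ := (((hdist.eventually (gt_mem_nhds hlt)).and
    (hU (hη0.eventually (gt_mem_nhds (show 0 < η i / 16 by linarith))))).and
    (hU (eventually_ge_atTop Q₁))).and (hU (eventually_ge_atTop ⌈η i / δ⌉₊)) |>.exists
  rw [dist_zero_right, ← nint_eq_norm] at hk1
  have hNR : (0 : ℝ) < N k := zero_lt_one.trans_le (hN1 k)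
  obtain ⟨m, -, hmN, hm⟩ := (hNp k).exists_nint_le (β - γ') (Nat.zero_le (N k))
  rw [zero_add] at hmN
  have hηk : 1 / ((k : ℝ) + 1) < η i / 16 := hk2
  have hm2 : nint (m * α - (β - γ')) ≤ (η i / 4) / N k :=
    hm.trans (by gcongr; linarith)
  set n := round (m * α - (β - γ'))
  have hnear : |γ' + m * α + (-n : ℤ) - β| ≤ (η i / 4) / N k := by
    have e : γ' + m * α + (-n : ℤ) - β = m * α - (β - γ') - n := by push_cast; ring
    rw [e]
    exact hm2
  have htail : ∀ q, m + Q₁ ≤ q → M - η (i + 1) / 2 ≤ scaledDist α (γ' + m * α + (-n : ℤ)) q := by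
    intro q hq
    rw [scaledDist_add_intCast]
    exact (hQ₁ _ (by omega)).trans (scaledDist_sub_le_shift α γ' (by omega))
  refine ⟨γ' + m * α + (-n : ℤ), ⟨?_, ?_⟩, hnear.trans ?_, fun q hq => ?_, ?_⟩
  · exact eventually_atTop.2 ⟨m + Q₁, htail⟩
  · rw [hφshift]
    exact hγ'.2
  · have h1 : η i / δ ≤ N k := (Nat.le_ceil _).trans (by exact_mod_cast hk4.trans (hkN k))
    rw [div_le_iff₀ hδ] at h1
    rw [div_le_iff₀ hNR]
    linarith
  · rcases lt_or_ge q (2 * N k) with h | h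
    · have h1 := scaledDist_le_add α β (γ' + m * α + (-n : ℤ)) q
      have h2 := hQ₀ q (hQ.trans hq)
      have h3 : (q : ℝ) * |γ' + m * α + (-n : ℤ) - β| ≤ η i / 2 := by
        have hq2 : (q : ℝ) ≤ 2 * N k := by exact_mod_cast h.le
        calc _ ≤ (2 * N k) * ((η i / 4) / N k) :=
              mul_le_mul hq2 hnear (abs_nonneg _) (by positivity)
          _ = η i / 2 := by field_simp; norm_num
      linarith
    · have h1 := htail q (by have := hkN k; omega)
      linarith [hηpos (i + 1)]
  · have h1 : Mplus α (γ' + m * α + (-n : ℤ)) < M + η i :=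
      (hM.1 ⟨_, rfl⟩).trans_lt (by linarith)
    obtain ⟨q, hq, hq'⟩ := frequently_atTop.1 (frequently_lt_of_liminf_lt
      (isCoboundedUnder_scaledDist hα hub _) h1) Q
    exact ⟨q, hq, le_of_lt hq'⟩

/-- If `α` is irrational with unbounded regular continued fraction partial
quotients, then `{M₊(α,β) : β ∈ ℝ} = [0, M₊(α)]` where `M₊(α) = sup_β M₊(α,β)`. -/
theorem stmt2 (α : ℝ) (hα : Irrational α)
    (hub : ∀ B : ℤ, ∃ n : ℕ, B < ⌊(gm α n)⁻¹⌋) :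
    {x : ℝ | ∃ β : ℝ, Mplus α β = x} = Set.Icc (0 : ℝ) (⨆ β : ℝ, Mplus α β) := by
  have hbdd : BddAbove (Set.range (Mplus α)) :=
    ⟨5, Set.forall_mem_range.2 fun β => Mplus_le_five hα hub β⟩
  ext x
  refine ⟨?_, fun ⟨hx0, hxM⟩ => ?_⟩
  · rintro ⟨β, rfl⟩
    exact ⟨Mplus_nonneg hα hub β, le_ciSup hbdd β⟩
  rcases hx0.eq_or_lt with rfl | hx0
  · exact exists_Mplus_eq_zero hα hub
  rcases hxM.eq_or_lt with rfl | hxM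
  · exact exists_Mplus_eq_of_isLUB hα hub (isLUB_ciSup hbdd)
  · obtain ⟨β, hβ⟩ := exists_lt_of_lt_ciSup hxM
    exact exists_Mplus_eq_of_lt hα hub hx0 hβ
end

section
/- Let α be irrational with 0 < α < 1 and let 0 < β < 1 have Davenport coefficients (b_i) with b_i ≠ 0 for infinitely many i. Then for every n ≥ 1 and every integer q with q_n ≤ q < q_{n+1}, one has q‖qα−β‖ ≥ min{ λ_n(β), ρ_n(β), λ_{n+1}(β), ρ_{n+1}(β) }. -/
open Filter Finset

theorem ncq_step {a : ℝ} (hirr : Irrational a) :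
    Irrational ((⌈a⁻¹⌉ : ℝ) - a⁻¹) ∧ 0 < (⌈a⁻¹⌉ : ℝ) - a⁻¹ ∧ (⌈a⁻¹⌉ : ℝ) - a⁻¹ < 1 := by
  have hi : Irrational ((⌈a⁻¹⌉ : ℝ) - a⁻¹) := (irrational_inv_iff.mpr hirr).intCast_sub _
  refine ⟨hi, lt_of_le_of_ne (sub_nonneg.mpr (Int.le_ceil _)) hi.ne_zero.symm, ?_⟩
  linarith [Int.ceil_lt_add_one a⁻¹]

theorem ncq_spec {α : ℝ} (hirr : Irrational α) (h0 : 0 < α) (h1 : α < 1) (i : ℕ) :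
    Irrational (ncq α i) ∧ 0 < ncq α i ∧ ncq α i < 1 := by
  induction i with
  | zero => exact ⟨hirr, h0, h1⟩
  | succ i ih => exact ncq_step ih.1

theorem npq_succ_mul_ncq {α : ℝ} (hirr : Irrational α) (h0 : 0 < α) (h1 : α < 1) (i : ℕ) :
    (npq α (i + 1) : ℝ) * ncq α i = 1 + ncq α i * ncq α (i + 1) := by
  have h := (ncq_spec hirr h0 h1 i).2.1
  simp only [npq, ncq, Nat.add_sub_cancel]
  field_simp
  ring

theorem two_le_npq_succ {α : ℝ} (hirr : Irrational α) (h0 : 0 < α) (h1 : α < 1) (i : ℕ) :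
    2 ≤ npq α (i + 1) := by
  have h := ncq_spec hirr h0 h1 i
  have : (1 : ℤ) < ⌈(ncq α i)⁻¹⌉ := by
    rw [Int.lt_ceil]
    exact_mod_cast (one_lt_inv₀ h.2.1).mpr h.2.2
  exact this

theorem nq_lt_nq_succ {α : ℝ} (hirr : Irrational α) (h0 : 0 < α) (h1 : α < 1) (i : ℕ) :
    0 < nq α i ∧ nq α i < nq α (i + 1) := by
  induction i with
  | zero =>
    have := two_le_npq_succ hirr h0 h1 0
    simp only [nq, zero_add] at this ⊢
    omega
  | succ i ih =>
    have := two_le_npq_succ hirr h0 h1 (i + 1)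
    refine ⟨by omega, ?_⟩
    change nq α (i + 1) < npq α (i + 2) * nq α (i + 1) - nq α i
    nlinarith

theorem nq_mul_np_sub (α : ℝ) (i : ℕ) :
    nq α i * np α (i + 1) - nq α (i + 1) * np α i = 1 := by
  induction i with
  | zero => simp [nq, np]
  | succ i ih =>
    simp only [nq, np]
    linear_combination ih

theorem Dk_succ (α : ℝ) (k : ℕ) : Dk α (k + 1) = Dk α k * ncq α k :=
  Finset.prod_range_succ _ _

theorem Dk_pos {α : ℝ} (hirr : Irrational α) (h0 : 0 < α) (h1 : α < 1) (k : ℕ) :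
    0 < Dk α k :=
  Finset.prod_pos fun j _ => (ncq_spec hirr h0 h1 j).2.1

theorem Dk_succ_eq {α : ℝ} (hirr : Irrational α) (h0 : 0 < α) (h1 : α < 1) (k : ℕ) :
    Dk α (k + 1) = nq α k * α - np α k ∧ Dk α (k + 2) = nq α (k + 1) * α - np α (k + 1) := by
  induction k with
  | zero =>
    have h := npq_succ_mul_ncq hirr h0 h1 0
    simp only [zero_add, show ncq α 0 = α from rfl] at h
    constructor
    · simp [Dk, nq, np, ncq]
    · rw [Dk_succ, Dk_succ]
      simp only [Dk, nq, np, Finset.range_zero, Finset.prod_empty,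
        show ncq α 0 = α from rfl]
      push_cast
      linarith
  | succ k ih =>
    refine ⟨ih.2, ?_⟩
    have h := npq_succ_mul_ncq hirr h0 h1 (k + 1)
    have e1 := Dk_succ α (k + 2)
    have e2 := Dk_succ α (k + 1)
    obtain ⟨i1, i2⟩ := ih
    simp only [nq, np]
    push_cast
    rw [show k + 1 + 2 = k + 2 + 1 from rfl, e1]
    rw [show k + 1 + 1 = k + 2 from rfl] at h e2
    linear_combination (npq α (k + 2) : ℝ) * i2 - i1 - Dk α (k + 1) * h
      + (ncq α (k + 2) - npq α (k + 2)) * e2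

theorem drem_mem {α β : ℝ} (hβ0 : 0 < β) (hβ1 : β < 1) (i : ℕ) :
    0 ≤ drem α β i ∧ drem α β i < 1 := by
  cases i with
  | zero => exact ⟨hβ0.le, hβ1⟩
  | succ i => exact ⟨Int.fract_nonneg _, Int.fract_lt_one _⟩

theorem ncq_mul_drem_succ {α : ℝ} (hirr : Irrational α) (h0 : 0 < α) (h1 : α < 1) (β : ℝ)
    (i : ℕ) : ncq α i * drem α β (i + 1) = drem α β i - db α β (i + 1) * ncq α i := by
  have h := (ncq_spec hirr h0 h1 i).2.1
  simp only [drem, db, Nat.add_sub_cancel, Int.fract]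
  field_simp

theorem db_succ_nonneg {α : ℝ} (hirr : Irrational α) (h0 : 0 < α) (h1 : α < 1) {β : ℝ}
    (hβ0 : 0 < β) (hβ1 : β < 1) (i : ℕ) : 0 ≤ db α β (i + 1) :=
  Int.floor_nonneg.mpr (div_nonneg (drem_mem hβ0 hβ1 i).1 (ncq_spec hirr h0 h1 i).2.1.le)

theorem Qn_succ (α β : ℝ) (n : ℕ) :
    Qn α β (n + 1) = Qn α β n + db α β (n + 1) * nq α n :=
  Finset.sum_Icc_succ_top (by omega) _

theorem Qn_nonneg {α : ℝ} (hirr : Irrational α) (h0 : 0 < α) (h1 : α < 1) {β : ℝ}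
    (hβ0 : 0 < β) (hβ1 : β < 1) (n : ℕ) : 0 ≤ Qn α β n := by
  induction n with
  | zero => simp [Qn]
  | succ n ih =>
    rw [Qn_succ]
    exact add_nonneg ih (mul_nonneg (db_succ_nonneg hirr h0 h1 hβ0 hβ1 n)
      (nq_lt_nq_succ hirr h0 h1 n).1.le)

theorem exists_eq_Qn_mul_sub {α : ℝ} (hirr : Irrational α) (h0 : 0 < α) (h1 : α < 1) (β : ℝ)
    (n : ℕ) : ∃ P : ℤ, β = Qn α β n * α - P + Dk α n * drem α β n := by
  induction n with
  | zero => exact ⟨0, by simp [Qn, Dk, drem]⟩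
  | succ n ih =>
    obtain ⟨P, hP⟩ := ih
    refine ⟨P + db α β (n + 1) * np α n, ?_⟩
    have h := ncq_mul_drem_succ hirr h0 h1 β n
    have e := Dk_succ α n
    have e' := (Dk_succ_eq hirr h0 h1 n).1
    rw [Qn_succ]
    push_cast
    linear_combination hP - Dk α n * h + (-db α β (n + 1) - drem α β (n + 1)) * e
      + db α β (n + 1) * e'

/-- One step of the admissibility invariant of Davenport coefficients. -/
theorem admissible_step {Q X Y A f : ℤ} {a b a' b' : ℝ} (hX : 0 ≤ X) (hXY : X < Y)
    (ha : 0 < a) (ha' : 0 < a') (hb : b < 1) (hb' : 0 ≤ b')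
    (hA : (A : ℝ) * a = 1 + a * a') (hf : a * b' = b - f * a)
    (hQ : Q < Y) (hinv : Y - X ≤ Q → b < 1 - a) :
    Q + f * Y < A * Y - X ∧ (A * Y - X - Y ≤ Q + f * Y → b' < 1 - a') := by
  have haa' := mul_pos ha ha'
  have hab' := mul_nonneg ha.le hb'
  have hfA : f < A := by
    have : (f : ℝ) * a < A * a := by linarith
    exact_mod_cast lt_of_mul_lt_mul_right this ha.le
  have hlast : f = A - 1 → Q < Y - X := by
    rintro rfl
    by_contra! hc
    have := hinv hc
    push_cast at hf
    linarith
  constructor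
  · rcases (by omega : f = A - 1 ∨ f ≤ A - 2) with h | h
    · have := hlast h
      subst h
      linarith
    · nlinarith
  · intro hc
    have hA2 : A - 2 ≤ f := by
      by_contra! h
      nlinarith
    have key : b < 1 + (f + 1 - A) * a := by
      rcases (by omega : f = A - 1 ∨ f = A - 2) with rfl | rfl
      · push_cast
        linarith
      · have := hinv (by linarith)
        push_cast
        linarith
    have : a * b' < a * (1 - a') := by linarith
    exact lt_of_mul_lt_mul_left this ha.le

/-- Lattice points with negative first coordinate and positive height lie beyond the next
convergent denominator. -/
theorem next_denominator_le {Q X Y A x y : ℤ} {a a' : ℝ} (hX : 0 ≤ X) (hXY : X < Y)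
    (ha : 0 < a) (ha1' : a' < 1) (hA : (A : ℝ) * a = 1 + a * a') (hA2 : 2 ≤ A)
    (hQ : 0 ≤ Q) (hx : x ≤ -1) (hpos : 0 < x + y * a) : A * Y - X ≤ Q + x * X + y * Y := by
  have hy : -x * (A - 1) < y := by
    have hx' : (x : ℝ) ≤ -1 := by exact_mod_cast hx
    have haa : (A - 1 : ℝ) * a < 1 := by nlinarith
    have : ((-x * (A - 1) : ℤ) : ℝ) * a < y * a := by
      push_cast
      nlinarith
    exact_mod_cast lt_of_mul_lt_mul_right this ha.le
  have h1 : 0 ≤ (-x - 1) * ((A - 1) * Y - X) := mul_nonneg (by omega) (by nlinarith)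
  have h2 : (-x * (A - 1) + 1) * Y ≤ y * Y := mul_le_mul_of_nonneg_right hy (by omega)
  linarith

/-- Lattice points with positive first coordinate in the range have height at least one. -/
theorem one_le_height {Q X Y x y : ℤ} {a : ℝ} (hX : 0 ≤ X) (hXY : X < Y)
    (ha : 0 < a) (ha1 : a < 1) (hQY : Q < Y) (hx : 1 ≤ x) (hq : Y ≤ Q + x * X + y * Y) :
    (1 : ℝ) ≤ x + y * a := by
  have hx' : (1 : ℝ) ≤ x := by exact_mod_cast hx
  rcases le_or_gt 0 y with hy | hy
  · have hy' : (0 : ℝ) ≤ y := by exact_mod_cast hy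
    nlinarith
  · have hy' : (y : ℝ) < 0 := by exact_mod_cast hy
    have : 1 - y ≤ x := by
      by_contra! hc
      nlinarith
    have : (1 - y : ℝ) ≤ x := by exact_mod_cast this
    nlinarith

theorem le_mul_of_height_le {Q X Y A f q x y : ℤ} {a b a' b' : ℝ} (hX : 0 ≤ X) (hXY : X < Y)
    (ha : 0 < a) (ha1 : a < 1) (ha1' : a' < 1) (hb0 : 0 ≤ b) (hb : b < 1) (hb' : b' < 1)
    (hA : (A : ℝ) * a = 1 + a * a') (hA2 : 2 ≤ A) (hf : a * b' = b - f * a)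
    (hQ : 0 ≤ Q) (hQY : Q < Y) (hq : q = Q + x * X + y * Y) (hYq : Y ≤ q)
    (hqA : q < A * Y - X) (hle : x + y * a ≤ b) :
    min (Q * b) (((Q + f * Y : ℤ) : ℝ) * (a * b')) ≤ q * (b - (x + y * a)) := by
  have hQR : (0 : ℝ) ≤ Q := by exact_mod_cast hQ
  have hQq : (Q : ℝ) ≤ q := by exact_mod_cast (by omega : Q ≤ q)
  rcases (by omega : x ≤ -1 ∨ x = 0 ∨ 1 ≤ x) with hx | rfl | hx
  · rcases le_or_gt ((x : ℝ) + y * a) 0 with h | h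
    · refine (min_le_left _ _).trans ?_
      exact mul_le_mul hQq (by linarith) hb0 (by linarith)
    · have := next_denominator_le hX hXY ha ha1' hA hA2 hQ hx h
      omega
  · have hyf : y ≤ f := by
      have : (y : ℝ) * a < ((f + 1 : ℤ) : ℝ) * a := by
        push_cast at hle ⊢
        nlinarith
      have : y < f + 1 := by exact_mod_cast lt_of_mul_lt_mul_right this ha.le
      omega
    have hy1 : 1 ≤ y := by
      by_contra! hc
      nlinarith
    have hYR : (0 : ℝ) < Y := by exact_mod_cast (by omega : 0 < Y)
    have hyfR : (y : ℝ) ≤ f := by exact_mod_cast hyf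
    have hyR : (1 : ℝ) ≤ y := by exact_mod_cast hy1
    have hfpos : (0 : ℝ) < f := by linarith
    have hcomb : f * ((q : ℝ) * (b - ((0 : ℤ) + y * a))) =
        (f - y) * (Q * b) + y * (((Q + f * Y : ℤ) : ℝ) * (a * b'))
          + f * (y * (f - y) * (Y * a)) := by
      rw [hf, hq]
      push_cast
      ring
    have hnn : 0 ≤ f * (y * (f - y) * (Y * a)) := by
      have : (0 : ℝ) ≤ f - y := by linarith
      positivity
    have h1 := mul_le_mul_of_nonneg_left
      (min_le_left (Q * b) (((Q + f * Y : ℤ) : ℝ) * (a * b'))) (sub_nonneg.mpr hyfR)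
    have h2 := mul_le_mul_of_nonneg_left
      (min_le_right (Q * b) (((Q + f * Y : ℤ) : ℝ) * (a * b'))) (by linarith : (0 : ℝ) ≤ y)
    refine le_of_mul_le_mul_left ?_ hfpos
    linarith
  · have := one_le_height hX hXY ha ha1 hQY hx (hq ▸ hYq)
    linarith

theorem le_mul_of_lt_height {Q X Y A f q x y : ℤ} {a b a' b' : ℝ} (hX : 0 ≤ X) (hXY : X < Y)
    (ha : 0 < a) (ha1 : a < 1) (ha1' : a' < 1) (hb0 : 0 ≤ b) (hb : b < 1) (hb0' : 0 ≤ b')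
    (hb' : b' < 1)
    (hA : (A : ℝ) * a = 1 + a * a') (hA2 : 2 ≤ A) (hf : a * b' = b - f * a) (hf0 : 0 ≤ f)
    (hQ : 0 ≤ Q) (hQY : Q < Y) (hq : q = Q + x * X + y * Y) (hYq : Y ≤ q)
    (hqA : q < A * Y - X) (hlt : b < x + y * a) :
    (if Q < Y - X then ((Q + X : ℤ) : ℝ) * (1 - b)
        else ((Q + X - Y : ℤ) : ℝ) * (1 - a - b)) ≤ q * (x + y * a - b) ∨
      (Q + f * Y < A * Y - X - Y ∧
        ((Q + f * Y + Y : ℤ) : ℝ) * (a * (1 - b')) ≤ q * (x + y * a - b)) := by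
  rcases (by omega : x ≤ -1 ∨ x = 0 ∨ 1 ≤ x) with hx | rfl | hx
  · have := next_denominator_le hX hXY ha ha1' hA hA2 hQ hx (hb0.trans_lt hlt)
    omega
  · right
    have hfy : f + 1 ≤ y := by
      have : (f : ℝ) * a < y * a := by
        push_cast at hlt
        nlinarith
      exact_mod_cast lt_of_mul_lt_mul_right this ha.le
    have hmul : (f + 1) * Y ≤ y * Y := mul_le_mul_of_nonneg_right hfy (by omega)
    have hfY : 0 ≤ f * Y := mul_nonneg hf0 (by omega)
    refine ⟨by linarith, ?_⟩
    have hfyR : (f + 1 : ℝ) ≤ y := by exact_mod_cast hfy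
    refine mul_le_mul ?_ ?_ (mul_nonneg ha.le (by linarith)) ?_
    · exact_mod_cast (by linarith : Q + f * Y + Y ≤ q)
    · push_cast
      nlinarith
    · exact_mod_cast (by omega : 0 ≤ q)
  · left
    have h := one_le_height hX hXY ha ha1 hQY hx (hq ▸ hYq)
    have hq0 : (0 : ℝ) ≤ q := by exact_mod_cast (by omega : 0 ≤ q)
    split_ifs with hc
    · refine mul_le_mul ?_ (by linarith) (by linarith) hq0
      exact_mod_cast (by omega : Q + X ≤ q)
    · refine (mul_le_mul_of_nonneg_left (by linarith : 1 - a - b ≤ x + y * a - b) ?_).trans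
        (mul_le_mul_of_nonneg_right ?_ (by linarith))
      · exact_mod_cast (by omega : 0 ≤ Q + X - Y)
      · exact_mod_cast (by omega : Q + X - Y ≤ q)

theorem Qn_succ_lt_and {α : ℝ} (hirr : Irrational α) (h0 : 0 < α) (h1 : α < 1) {β : ℝ}
    (hβ0 : 0 < β) (hβ1 : β < 1) (n : ℕ) :
    Qn α β (n + 1) < nq α (n + 1) ∧
      (nq α (n + 1) - nq α n ≤ Qn α β (n + 1) → drem α β (n + 1) < 1 - ncq α (n + 1)) := by
  induction n with
  | zero =>
    have := admissible_step (Q := 0) (X := 0) (Y := 1) le_rfl one_pos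
      (ncq_spec hirr h0 h1 0).2.1 (ncq_spec hirr h0 h1 1).2.1 (drem_mem hβ0 hβ1 0).2
      (drem_mem hβ0 hβ1 1).1 (npq_succ_mul_ncq hirr h0 h1 0)
      (ncq_mul_drem_succ hirr h0 h1 β 0) one_pos (fun h => absurd h (by norm_num))
    simpa [Qn, nq] using this
  | succ n ih =>
    have hq := nq_lt_nq_succ hirr h0 h1 n
    have := admissible_step hq.1.le hq.2
      (ncq_spec hirr h0 h1 (n + 1)).2.1 (ncq_spec hirr h0 h1 (n + 2)).2.1
      (drem_mem hβ0 hβ1 (n + 1)).2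
      (drem_mem hβ0 hβ1 (n + 2)).1 (npq_succ_mul_ncq hirr h0 h1 (n + 1))
      (ncq_mul_drem_succ hirr h0 h1 β (n + 1)) ih.1 ih.2
    rw [Qn_succ]
    exact this

/-- For irrational `0 < α < 1` and `0 < β < 1` with Davenport coefficients
nonzero infinitely often, for every `n ≥ 1` and integer `q` with `q_n ≤ q < q_{n+1}`,
`q‖qα−β‖ ≥ min{λ_n(β), ρ_n(β), λ_{n+1}(β), ρ_{n+1}(β)}`. -/
theorem stmt5 (α : ℝ) (hirr : Irrational α) (h0 : 0 < α) (h1 : α < 1)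
    (β : ℝ) (hβ0 : 0 < β) (hβ1 : β < 1)
    (hinf : {i : ℕ | db α β i ≠ 0}.Infinite) :
    ∀ n : ℕ, 1 ≤ n → ∀ q : ℤ, nq α n ≤ q → q < nq α (n + 1) →
      min (min (lam α β n) (rho α β n)) (min (lam α β (n + 1)) (rho α β (n + 1))) ≤
        (q : ℝ) * nint (q * α - β) := by
  intro n hn q hqn hqn1
  obtain ⟨m, rfl⟩ : ∃ m, n = m + 1 := ⟨n - 1, by omega⟩
  obtain ⟨P, hP⟩ := exists_eq_Qn_mul_sub hirr h0 h1 β (m + 1)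
  have hdet := nq_mul_np_sub α m
  have hX := nq_lt_nq_succ hirr h0 h1 m
  have hD := Dk_pos hirr h0 h1 (m + 1)
  obtain ⟨hD1, hD2⟩ := Dk_succ_eq hirr h0 h1 m
  have hDs := Dk_succ α (m + 1)
  obtain ⟨-, ha, ha1⟩ := ncq_spec hirr h0 h1 (m + 1)
  obtain ⟨-, -, ha1'⟩ := ncq_spec hirr h0 h1 (m + 2)
  obtain ⟨hb0, hb⟩ := drem_mem hβ0 hβ1 (m + 1)
  obtain ⟨hb0', hb'⟩ := drem_mem hβ0 hβ1 (m + 2)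
  have hA := npq_succ_mul_ncq hirr h0 h1 (m + 1)
  have hA2 := two_le_npq_succ hirr h0 h1 (m + 1)
  have hf := ncq_mul_drem_succ hirr h0 h1 β (m + 1)
  have hf0 := db_succ_nonneg hirr h0 h1 hβ0 hβ1 (m + 1)
  have hQ := Qn_nonneg hirr h0 h1 hβ0 hβ1 (m + 1)
  have hQY := (Qn_succ_lt_and hirr h0 h1 hβ0 hβ1 m).1
  have hQs := Qn_succ α β (m + 1)
  have hqs : nq α (m + 1 + 1) = npq α (m + 1 + 1) * nq α (m + 1) - nq α m := rfl
  rw [hqs] at hqn1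
  unfold nint
  set r := round ((q : ℝ) * α - β)
  obtain ⟨x, y, hqxy, hrxy⟩ : ∃ x y : ℤ,
      q = Qn α β (m + 1) + x * nq α m + y * nq α (m + 1) ∧
        r = P + x * np α m + y * np α (m + 1) := by
    refine ⟨(q - Qn α β (m + 1)) * np α (m + 1) - (r - P) * nq α (m + 1),
      (r - P) * nq α m - (q - Qn α β (m + 1)) * np α m, ?_, ?_⟩
    · linear_combination (Qn α β (m + 1) - q) * hdet
    · linear_combination (P - r) * hdet
  have hδ : (q : ℝ) * α - β - r = Dk α (m + 1) *
      (x + y * ncq α (m + 1) - drem α β (m + 1)) := by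
    rw [hqxy, hrxy]
    push_cast
    linear_combination -hP - x * hD1 - y * hD2 + y * hDs
  rw [hδ, abs_mul, abs_of_pos hD]
  rcases le_or_gt ((x : ℝ) + y * ncq α (m + 1)) (drem α β (m + 1)) with h | h
  · rw [abs_of_nonpos (by linarith)]
    have key := mul_le_mul_of_nonneg_left (le_mul_of_height_le hX.1.le hX.2 ha ha1 ha1' hb0 hb hb'
      hA hA2 hf hQ hQY hqxy hqn hqn1 h) hD.le
    rw [mul_min_of_nonneg _ _ hD.le, min_le_iff] at key
    rcases key with key | key
    · refine ((min_le_left _ _).trans (min_le_left _ _)).trans ?_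
      unfold lam
      linarith
    · refine ((min_le_right _ _).trans (min_le_left _ _)).trans ?_
      unfold lam
      rw [hDs, hQs]
      linarith
  · rw [abs_of_pos (by linarith)]
    rcases le_mul_of_lt_height hX.1.le hX.2 ha ha1 ha1' hb0 hb hb0' hb'
      hA hA2 hf hf0 hQ hQY hqxy hqn hqn1 h with key | ⟨hc, key⟩
    · refine ((min_le_left _ _).trans (min_le_right _ _)).trans ?_
      replace key := mul_le_mul_of_nonneg_left key hD.le
      simp only [rho, Qn', Nat.add_sub_cancel]
      split_ifs at key ⊢ <;> linarith
    · refine ((min_le_right _ _).trans (min_le_right _ _)).trans ?_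
      replace key := mul_le_mul_of_nonneg_left key hD.le
      simp only [rho, Qn', Nat.add_sub_cancel]
      rw [hQs, hqs, if_pos hc, if_pos hc, hDs]
      linarith
end

section
/- Let α be irrational with 0 < α < 1. Then for every k ≥ 1, q_k − 1 = (a₁ − 2)q₀ + (a₂ − 2)q₁ + ⋯ + (a_{k−1} − 2)q_{k−2} + (a_k − 1)q_{k−1}. -/
open Filter Finset

/-- For every `k ≥ 1`,
`q_k − 1 = (a₁−2)q₀ + (a₂−2)q₁ + ⋯ + (a_{k−1}−2)q_{k−2} + (a_k−1)q_{k−1}`. -/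
theorem stmt12 (α : ℝ) (hirr : Irrational α) (h0 : 0 < α) (h1 : α < 1) :
    ∀ k : ℕ, 1 ≤ k →
      nq α k - 1 =
        (∑ i ∈ Finset.Icc 1 (k - 1), (npq α i - 2) * nq α (i - 1)) +
          (npq α k - 1) * nq α (k - 1) := by
  intro k hk
  induction k, hk using Nat.le_induction with
  | base => simp [nq]
  | succ n hn ih =>
    obtain ⟨m, rfl⟩ : ∃ m, n = m + 1 := ⟨n - 1, by omega⟩
    simp only [Nat.add_sub_cancel] at ih ⊢
    rw [Finset.sum_Icc_succ_top (by omega), Nat.add_sub_cancel]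
    have hq : nq α (m + 1 + 1) = npq α (m + 1 + 1) * nq α (m + 1) - nq α m := rfl
    linear_combination hq + ih
end

section
/- Let α be irrational with 0 < α < 1, and suppose its negative continued fraction partial quotients satisfy a_i ≤ M for all i ≥ 1 and contain no block of N consecutive terms equal to 2 (where M and N are positive integers, N ≥ 1). Then for all i ≥ 1, 1/M ≤ ᾱ_i < N/(N+1). -/
open Filter Finset

/-- Every complete quotient of an irrational number in `(0, 1)` is an irrational number in
`(0, 1)`. -/
theorem ncq_irrational_mem_Ioo {α : ℝ} (hirr : Irrational α) (hα : α ∈ Set.Ioo 0 1) (i : ℕ) :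
    Irrational (ncq α i) ∧ ncq α i ∈ Set.Ioo 0 1 := by
  induction i with
  | zero => exact ⟨hirr, hα⟩
  | succ i ih =>
    have hinv : Irrational (ncq α i)⁻¹ := irrational_inv_iff.mpr ih.1
    have hne : (ncq α i)⁻¹ ≠ (⌈(ncq α i)⁻¹⌉ : ℝ) := hinv.ne_int _
    refine ⟨hinv.intCast_sub _, ?_, ?_⟩
    · exact sub_pos.mpr (lt_of_le_of_ne (Int.le_ceil _) hne)
    · exact sub_lt_iff_lt_add'.mpr (Int.ceil_lt_add_one _)

/-- The partial quotients of an irrational number in `(0, 1)` are at least `2`. -/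
theorem two_le_npq {α : ℝ} (hirr : Irrational α) (hα : α ∈ Set.Ioo 0 1) (i : ℕ) :
    2 ≤ npq α i := by
  obtain ⟨-, hpos, hlt⟩ := ncq_irrational_mem_Ioo hirr hα (i - 1)
  have h : (1 : ℤ) < npq α i := by
    rw [npq, Int.lt_ceil]
    exact_mod_cast (one_lt_inv₀ hpos).mpr hlt
  lia

/-- The `i`-th reversed quotient is controlled by the number `k` of trailing partial quotients
equal to `2`. -/
theorem exists_trailing_twos_rq_lt {α : ℝ} (h2 : ∀ i, 2 ≤ npq α i) (i : ℕ) :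
    ∃ k ≤ i, (∀ j, i < j + k → j ≤ i → npq α j = 2) ∧
      0 ≤ rq α i ∧ rq α i < (k + 1) / (k + 2) := by
  induction i with
  | zero => exact ⟨0, le_rfl, fun j hj hj' => by lia, by simp [rq], by norm_num [rq]⟩
  | succ i ih =>
    obtain ⟨k, hki, hk, hr0, hr⟩ := ih
    have hr1 : rq α i < 1 := hr.trans ((div_lt_one (by positivity)).mpr (by linarith))
    rcases (h2 (i + 1)).eq_or_lt with ha | ha
    · refine ⟨k + 1, by lia, fun j hj hj' => ?_, ?_⟩
      · rcases hj'.eq_or_lt with rfl | hlt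
        · exact ha.symm
        · exact hk j (by lia) (by lia)
      · rw [rq, ← ha]
        push_cast
        rw [lt_div_iff₀ (by positivity)] at hr
        refine ⟨inv_nonneg.mpr (by linarith), ?_⟩
        rw [inv_eq_one_div, div_lt_div_iff₀ (by linarith) (by positivity)]
        linarith
    · have ha' : (3 : ℝ) ≤ npq α (i + 1) := by exact_mod_cast ha
      refine ⟨0, by lia, fun j hj hj' => by lia, ?_⟩
      rw [rq]
      refine ⟨inv_nonneg.mpr (by linarith), ?_⟩
      rw [inv_eq_one_div, div_lt_div_iff₀ (by linarith) (by positivity)]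
      push_cast
      linarith

/-- If the negative continued fraction partial quotients of `α` satisfy
`a_i ≤ M` for all `i ≥ 1` and contain no block of `N` consecutive terms equal to `2`, then
for all `i ≥ 1`, `1/M ≤ ᾱ_i < N/(N+1)`. -/
theorem stmt14 (α : ℝ) (hirr : Irrational α) (h0 : 0 < α) (h1 : α < 1)
    (M N : ℕ) (hM0 : 0 < M) (hN0 : 1 ≤ N)
    (hM : ∀ i : ℕ, 1 ≤ i → npq α i ≤ (M : ℤ))
    (hN : ¬ ∃ i : ℕ, 1 ≤ i ∧ ∀ k : ℕ, i ≤ k → k < i + N → npq α k = 2) :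
    ∀ i : ℕ, 1 ≤ i → ((M : ℝ))⁻¹ ≤ rq α i ∧ rq α i < (N : ℝ) / ((N : ℝ) + 1) := by
  have h2 := two_le_npq hirr ⟨h0, h1⟩
  have hlt : ∀ i, 0 ≤ rq α i ∧ rq α i < (N : ℝ) / ((N : ℝ) + 1) := by
    intro i
    obtain ⟨k, hki, hk, hr0, hr⟩ := exists_trailing_twos_rq_lt h2 i
    have hkN : k + 1 ≤ N := by
      by_contra! h
      exact hN ⟨i + 1 - N, by lia, fun j hj hj' => hk j (by lia) (by lia)⟩
    have hkN' : (k : ℝ) + 1 ≤ N := by exact_mod_cast hkN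
    refine ⟨hr0, hr.trans_le ?_⟩
    rw [div_le_div_iff₀ (by positivity) (by positivity)]
    linarith
  rintro (_ | i) hi
  · lia
  refine ⟨?_, (hlt (i + 1)).2⟩
  have hr1 : rq α i < 1 := (hlt i).2.trans ((div_lt_one (by positivity)).mpr (by linarith))
  have ha : (2 : ℝ) ≤ npq α (i + 1) := by exact_mod_cast h2 (i + 1)
  have haM : (npq α (i + 1) : ℝ) ≤ M := by exact_mod_cast hM (i + 1) hi
  exact inv_anti₀ (by linarith) (by linarith [(hlt i).1])
end
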